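/- Given c ∈ ℭ_+ and a sequence γ = (γ_k)_{k∈Λ} with γ_0 = 1 and γ_{−k} = conj(γ_k), the sublevel sets J^{−1}((−∞, r]) ⊆ 𝔓̄_{+,∘} × (𝔓̄_+ \ {0}) of the functional J(P,Q) are compact for all r ∈ ℝ. -/

import Mathlib

open MeasureTheory Complex Set

noncomputable section

namespace RCE

/-- The scalar product (k,θ) = Σⱼ kⱼ θⱼ. -/
def dotP (d : ℕ) (k : Fin d → ℤ) (θ : Fin d → ℝ) : ℝ := ∑ j, (k j : ℝ) * θ j

/-- The d-dimensional torus 𝕋^d = (−π,π]^d. -/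
def Td (d : ℕ) : Set (Fin d → ℝ) := Set.univ.pi fun _ => Set.Ioc (-Real.pi) Real.pi

/-- Normalized Lebesgue measure dm = (2π)^{-d} dθ on 𝕋^d. -/
def dm (d : ℕ) : Measure (Fin d → ℝ) :=
  (ENNReal.ofReal ((2 * Real.pi) ^ d))⁻¹ • (volume.restrict (Td d))

/-- Conjugate-symmetric coefficient sequences supported on Λ. -/
def IsCoeff (d : ℕ) (Λ : Finset (Fin d → ℤ)) (p : (Fin d → ℤ) → ℂ) : Prop :=
  (∀ k, k ∉ Λ → p k = 0) ∧ ∀ k, p (-k) = starRingEnd ℂ (p k)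

/-- Evaluation of the (real-valued) trigonometric polynomial
`P(e^{iθ}) = Σ_{k∈Λ} p_k e^{-i(k,θ)}`. -/
def eval (d : ℕ) (Λ : Finset (Fin d → ℤ)) (p : (Fin d → ℤ) → ℂ) (θ : Fin d → ℝ) : ℝ :=
  (∑ k ∈ Λ, p k * Complex.exp (-(dotP d k θ : ℂ) * Complex.I)).re

/-- `𝔓̄₊` : the closed cone of nonnegative trigonometric polynomials. -/
def Pbar (d : ℕ) (Λ : Finset (Fin d → ℤ)) : Set ((Fin d → ℤ) → ℂ) :=
  {p | IsCoeff d Λ p ∧ ∀ θ ∈ Td d, 0 ≤ eval d Λ p θ}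

/-- `𝔓₊` : the open cone of positive trigonometric polynomials. -/
def Pplus (d : ℕ) (Λ : Finset (Fin d → ℤ)) : Set ((Fin d → ℤ) → ℂ) :=
  {p | IsCoeff d Λ p ∧ ∀ θ ∈ Td d, 0 < eval d Λ p θ}

/-- The pairing ⟨c,p⟩ = Σ_{k∈Λ} c_k conj(p_k) (real-valued by conjugate symmetry). -/
def pair (d : ℕ) (Λ : Finset (Fin d → ℤ)) (c p : (Fin d → ℤ) → ℂ) : ℝ :=
  (∑ k ∈ Λ, c k * starRingEnd ℂ (p k)).re

/-- `ℭ₊` : the interior of the dual cone. -/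
def Cplus (d : ℕ) (Λ : Finset (Fin d → ℤ)) : Set ((Fin d → ℤ) → ℂ) :=
  {c | IsCoeff d Λ c ∧ ∀ p ∈ Pbar d Λ, p ≠ 0 → 0 < pair d Λ c p}

/-- `ℭ̄₊` : the closed dual cone. -/
def Cbar (d : ℕ) (Λ : Finset (Fin d → ℤ)) : Set ((Fin d → ℤ) → ℂ) :=
  {c | IsCoeff d Λ c ∧ ∀ p ∈ Pbar d Λ, 0 ≤ pair d Λ c p}

/-- The dual functional J_P(Q) = ⟨c,q⟩ − ∫ P log Q dm. -/
def J (d : ℕ) (Λ : Finset (Fin d → ℤ)) (c P Q : (Fin d → ℤ) → ℂ) : ℝ :=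
  pair d Λ c Q - ∫ θ, eval d Λ P θ * Real.log (eval d Λ Q θ) ∂(dm d)

/-- Covariance matching for an absolutely continuous measure Φ dm:
`c_k = ∫ e^{i(k,θ)} Φ(θ) dm(θ)` for all k ∈ Λ. -/
def Matches (d : ℕ) (Λ : Finset (Fin d → ℤ)) (c : (Fin d → ℤ) → ℂ)
    (Φ : (Fin d → ℝ) → ℝ) : Prop :=
  ∀ k ∈ Λ, c k = ∫ θ, Complex.exp ((dotP d k θ : ℂ) * Complex.I) * (Φ θ : ℂ) ∂(dm d)

/-- `𝔓̄₊,∘` : nonnegative trigonometric polynomials normalized by p₀ = 1. -/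
def Pbaro (d : ℕ) (Λ : Finset (Fin d → ℤ)) : Set ((Fin d → ℤ) → ℂ) :=
  {p | p ∈ Pbar d Λ ∧ p 0 = 1}

/-- `𝔓₊,∘` : positive trigonometric polynomials normalized by p₀ = 1. -/
def Ppluso (d : ℕ) (Λ : Finset (Fin d → ℤ)) : Set ((Fin d → ℤ) → ℂ) :=
  {p | p ∈ Pplus d Λ ∧ p 0 = 1}

/-- The functional J(P,Q) = ⟨c,q⟩ − ⟨γ,p⟩ + ∫ P log(P/Q) dm, with the convention
P log(P/Q) := 0 where P = 0. -/
def J2 (d : ℕ) (Λ : Finset (Fin d → ℤ)) (c γ P Q : (Fin d → ℤ) → ℂ) : ℝ :=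
  pair d Λ c Q - pair d Λ γ P +
    ∫ θ, (if eval d Λ P θ = 0 then 0
          else eval d Λ P θ * Real.log (eval d Λ P θ / eval d Λ Q θ)) ∂(dm d)

/-- The complex trigonometric polynomial whose real part is `eval`. -/
def ceval (d : ℕ) (Λ : Finset (Fin d → ℤ)) (p : (Fin d → ℤ) → ℂ) (θ : Fin d → ℝ) : ℂ :=
  ∑ k ∈ Λ, p k * Complex.exp (-(dotP d k θ : ℂ) * Complex.I)

section Torus

variable {d : ℕ}

instance fact_two_pi_pos : Fact (0 < 2 * Real.pi) := ⟨Real.two_pi_pos⟩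

lemma volume_restrict_Td :
    (volume : Measure (Fin d → ℝ)).restrict (Td d) =
      Measure.pi fun _ => volume.restrict (Ioc (-Real.pi) Real.pi) := by
  rw [Td, volume_pi, Measure.restrict_pi_pi]

lemma measurePreserving_torus_mk :
    MeasurePreserving (fun (θ : Fin d → ℝ) j => (θ j : AddCircle (2 * Real.pi)))
      (volume.restrict (Td d)) volume := by
  rw [volume_restrict_Td, volume_pi]
  refine measurePreserving_pi _ _ fun _ => ?_
  have h := AddCircle.measurePreserving_mk (2 * Real.pi) (-Real.pi)
  rwa [show -Real.pi + 2 * Real.pi = Real.pi by ring] at h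

lemma volume_Td : volume (Td d) = ENNReal.ofReal ((2 * Real.pi) ^ d) := by
  rw [Td, volume_pi_pi]
  simp only [Real.volume_Ioc, Finset.prod_const, Finset.card_univ, Fintype.card_fin]
  rw [ENNReal.ofReal_pow Real.two_pi_pos.le]
  congr 2; ring

instance isProbabilityMeasure_dm : IsProbabilityMeasure (dm d) := by
  constructor
  rw [dm, Measure.smul_apply, Measure.restrict_apply_univ, volume_Td, smul_eq_mul]
  exact ENNReal.inv_mul_cancel (by simpa using by positivity) ENNReal.ofReal_ne_top

lemma measurableSet_Td : MeasurableSet (Td d) :=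
  MeasurableSet.univ_pi fun _ => measurableSet_Ioc

lemma ae_dm_mem_Td : ∀ᵐ θ ∂dm d, θ ∈ Td d :=
  Measure.smul_absolutelyContinuous (ae_restrict_mem measurableSet_Td)

/-- The canonical representative in `ℝ^d` of a point of the torus. -/
def torusRep (x : Fin d → AddCircle (2 * Real.pi)) : Fin d → ℝ :=
  fun j => (AddCircle.measurableEquivIoc (2 * Real.pi) (-Real.pi) (x j) : ℝ)

lemma measurable_torusRep : Measurable (torusRep (d := d)) := by
  refine measurable_pi_lambda _ fun j => ?_
  exact measurable_subtype_coe.comp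
    ((AddCircle.measurableEquivIoc (2 * Real.pi) (-Real.pi)).measurable.comp (measurable_pi_apply j))

lemma coe_torusRep (x : Fin d → AddCircle (2 * Real.pi)) (j : Fin d) :
    ((torusRep x j : ℝ) : AddCircle (2 * Real.pi)) = x j :=
  (AddCircle.equivIoc (2 * Real.pi) (-Real.pi)).symm_apply_apply (x j)

/-- Averaging a periodic function over the torus along a family of parallel lines. -/
lemma two_pi_mul_lintegral_dm_le {G : (Fin d → ℝ) → ENNReal} (hG : Measurable G)
    (hper : ∀ θ (n : Fin d → ℤ), G (fun j => θ j + 2 * Real.pi * n j) = G θ)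
    (v : Fin d → ℝ) {C : ENNReal}
    (hC : ∀ θ, ∫⁻ t in Ioc 0 (2 * Real.pi), G (θ + t • v) ≤ C) :
    ENNReal.ofReal (2 * Real.pi) * ∫⁻ θ, G θ ∂dm d ≤ C := by
  let mk : (Fin d → ℝ) → Fin d → AddCircle (2 * Real.pi) := fun θ j => (θ j : AddCircle _)
  have hmk : Measurable mk := measurePreserving_torus_mk.measurable
  have hmk_add : ∀ θ φ, mk (θ + φ) = mk θ + mk φ := fun θ φ => by ext j; simp [mk]
  let H : (Fin d → AddCircle (2 * Real.pi)) → ENNReal := fun x => G (torusRep x)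
  have hH : Measurable H := hG.comp measurable_torusRep
  have hHmk : ∀ θ, H (mk θ) = G θ := by
    intro θ
    have h : ∀ j, ∃ n : ℤ, torusRep (mk θ) j = θ j + 2 * Real.pi * n := by
      intro j
      have h1 := coe_torusRep (mk θ) j
      obtain ⟨n, hn⟩ := Real.Angle.angle_eq_iff_two_pi_dvd_sub.1 h1
      exact ⟨n, by linarith⟩
    choose n hn using h
    have : torusRep (mk θ) = fun j => θ j + 2 * Real.pi * n j := funext hn
    simp only [H, this, hper]
  have hline : ∀ x, ∫⁻ t in Ioc 0 (2 * Real.pi), H (x + mk (t • v)) ≤ C := by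
    intro x
    have hx : mk (torusRep x) = x := funext (coe_torusRep x)
    refine le_trans (le_of_eq ?_) (hC (torusRep x))
    refine lintegral_congr fun t => ?_
    rw [← hHmk, hmk_add, hx]
  have hmeas : Measurable fun z : (Fin d → AddCircle (2 * Real.pi)) × ℝ =>
      H (z.1 + mk (z.2 • v)) := by
    refine hH.comp (measurable_fst.add (hmk.comp ?_))
    fun_prop
  have hvol : volume (univ : Set (Fin d → AddCircle (2 * Real.pi))) =
      ENNReal.ofReal ((2 * Real.pi) ^ d) := by
    rw [← measurePreserving_torus_mk.measure_preimage MeasurableSet.univ.nullMeasurableSet,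
      preimage_univ, Measure.restrict_apply_univ, volume_Td]
  have key : ENNReal.ofReal (2 * Real.pi) * ∫⁻ x, H x ≤
      C * ENNReal.ofReal ((2 * Real.pi) ^ d) := by
    calc ENNReal.ofReal (2 * Real.pi) * ∫⁻ x, H x
        = ∫⁻ t in Ioc 0 (2 * Real.pi), ∫⁻ x, H (x + mk (t • v)) := by
          simp_rw [lintegral_add_right_eq_self H]
          rw [lintegral_const, Measure.restrict_apply_univ, Real.volume_Ioc, sub_zero, mul_comm]
      _ = ∫⁻ x, ∫⁻ t in Ioc 0 (2 * Real.pi), H (x + mk (t • v)) :=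
          (lintegral_lintegral_swap hmeas.aemeasurable).symm
      _ ≤ ∫⁻ _, C := lintegral_mono hline
      _ = C * ENNReal.ofReal ((2 * Real.pi) ^ d) := by rw [lintegral_const, hvol]
  have hint : ∫⁻ θ, G θ ∂dm d = (ENNReal.ofReal ((2 * Real.pi) ^ d))⁻¹ * ∫⁻ x, H x := by
    rw [dm, lintegral_smul_measure, ← measurePreserving_torus_mk.lintegral_comp hH, smul_eq_mul]
    congr 1
    exact lintegral_congr fun θ => (hHmk θ).symm
  rw [hint, mul_left_comm]
  refine (mul_le_mul_right key _).trans (le_of_eq ?_)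
  rw [mul_left_comm, ENNReal.inv_mul_cancel (by simpa using by positivity) ENNReal.ofReal_ne_top,
    mul_one]

end Torus

section OneVariable

open Polynomial in
lemma lintegral_log_norm_polynomial_le {g : ℂ[X]} {δ L : ℝ} (hδ : 0 < δ)
    (hg : δ ≤ ‖g.leadingCoeff‖)
    (hL : ∀ t : ℝ, Real.log ‖g.eval (circleMap 0 1 t)‖ ≤ L) :
    (∀ᵐ t : ℝ, g.eval (circleMap 0 1 t) ≠ 0) ∧
    ∫⁻ t in Ioc 0 (2 * Real.pi), ENNReal.ofReal (L - Real.log ‖g.eval (circleMap 0 1 t)‖) ≤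
      ENNReal.ofReal (2 * Real.pi * (L - Real.log δ)) := by
  have hg0 : g ≠ 0 := by
    rintro rfl
    simp at hg
    linarith
  constructor
  · have hc : (circleMap 0 1 ⁻¹' {z | g.eval z = 0}).Countable :=
      (g.finite_setOfPred_isRoot hg0).countable.preimage_circleMap 0 one_ne_zero
    exact hc.ae_notMem volume
  · have hi := g.intervalIntegrable_mahlerMeasure
    have hi' := (intervalIntegrable_iff_integrableOn_Ioc_of_le Real.two_pi_pos.le).1 hi
    rw [← ofReal_integral_eq_lintegral_ofReal
      (f := fun t => L - Real.log ‖g.eval (circleMap 0 1 t)‖) ((integrable_const L).sub hi')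
      (Filter.Eventually.of_forall fun t => sub_nonneg.2 (hL t))]
    refine ENNReal.ofReal_le_ofReal ?_
    rw [integral_sub (integrable_const L) hi', setIntegral_const, measureReal_def,
      Real.volume_Ioc, sub_zero,
      ENNReal.toReal_ofReal Real.two_pi_pos.le, smul_eq_mul,
      ← intervalIntegral.integral_of_le Real.two_pi_pos.le]
    have hM : Real.log δ ≤ g.logMahlerMeasure := by
      rw [logMahlerMeasure_eq_log_leadingCoeff_add_sum_log_roots]
      have h1 := Real.log_le_log hδ hg
      have h2 : 0 ≤ (g.roots.map (fun a ↦ Real.posLog ‖a‖)).sum := by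
        refine Multiset.sum_nonneg fun x hx => ?_
        obtain ⟨a, -, rfl⟩ := Multiset.mem_map.1 hx
        exact Real.posLog_nonneg
      linarith
    rw [logMahlerMeasure_def, Real.circleAverage_def, smul_eq_mul,
      le_inv_mul_iff₀ Real.two_pi_pos] at hM
    linarith

end OneVariable
section TrigPoly

variable {d : ℕ} {Λ : Finset (Fin d → ℤ)} {p : (Fin d → ℤ) → ℂ}

lemma dotP_add_smul (k : Fin d → ℤ) (θ v : Fin d → ℝ) (t : ℝ) :
    dotP d k (θ + t • v) = dotP d k θ + t * dotP d k v := by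
  simp only [dotP, Pi.add_apply, Pi.smul_apply, smul_eq_mul, Finset.mul_sum,
    ← Finset.sum_add_distrib]
  exact Finset.sum_congr rfl fun j _ => by ring

lemma continuous_dotP (k : Fin d → ℤ) : Continuous (dotP d k) := by
  unfold dotP; fun_prop

lemma norm_character (x : ℝ) : ‖Complex.exp (-(x : ℂ) * Complex.I)‖ = 1 := by
  rw [← Complex.ofReal_neg, Complex.norm_exp_ofReal_mul_I]

lemma continuous_ceval (p : (Fin d → ℤ) → ℂ) : Continuous (ceval d Λ p) := by
  unfold ceval
  have := fun k => continuous_dotP (d := d) k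
  fun_prop

lemma continuous_eval (p : (Fin d → ℤ) → ℂ) : Continuous (eval d Λ p) :=
  Complex.continuous_re.comp (continuous_ceval p)

lemma continuous_eval_coeff (θ : Fin d → ℝ) : Continuous fun p => eval d Λ p θ := by
  unfold eval
  fun_prop

lemma ceval_periodic (θ : Fin d → ℝ) (n : Fin d → ℤ) :
    ceval d Λ p (fun j => θ j + 2 * Real.pi * n j) = ceval d Λ p θ := by
  refine Finset.sum_congr rfl fun k _ => ?_
  congr 1
  rw [Complex.exp_eq_exp_iff_exists_int]
  refine ⟨-∑ j, k j * n j, ?_⟩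
  have : dotP d k (fun j => θ j + 2 * Real.pi * n j) =
      dotP d k θ + 2 * Real.pi * ((∑ j, k j * n j : ℤ) : ℝ) := by
    push_cast
    simp only [dotP, Finset.mul_sum, ← Finset.sum_add_distrib]
    exact Finset.sum_congr rfl fun j _ => by ring
  rw [this]
  push_cast
  ring

lemma norm_ceval_le (θ : Fin d → ℝ) : ‖ceval d Λ p θ‖ ≤ ∑ k ∈ Λ, ‖p k‖ := by
  refine (norm_sum_le _ _).trans (Finset.sum_le_sum fun k _ => ?_)
  rw [norm_mul, norm_character, mul_one]

lemma ceval_eq_eval (hΛ : ∀ k ∈ Λ, -k ∈ Λ) (hp : IsCoeff d Λ p) (θ : Fin d → ℝ) :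
    ceval d Λ p θ = (eval d Λ p θ : ℂ) := by
  refine (Complex.conj_eq_iff_re.1 ?_).symm
  rw [ceval, map_sum]
  refine Finset.sum_nbij' (fun k => -k) (fun k => -k) hΛ hΛ (fun _ _ => neg_neg _)
    (fun _ _ => neg_neg _) fun k _ => ?_
  have : dotP d (-k) θ = -dotP d k θ := by simp [dotP]
  rw [hp.2, this, map_mul, ← Complex.exp_conj]
  simp

/-- Some integer direction separates the frequencies in `Λ`. -/
lemma exists_injOn_dot (Λ : Finset (Fin d → ℤ)) :
    ∃ v : Fin d → ℤ, Set.InjOn (fun k : Fin d → ℤ => ∑ j, k j * v j) Λ := by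
  classical
  let f : (Fin d → ℤ) → Polynomial ℤ := fun k => ∑ j : Fin d, Polynomial.monomial j (k j)
  have hf : ∀ k (j : Fin d), (f k).coeff j = k j := by
    intro k j
    simp only [f, Polynomial.finsetSum_coeff, Polynomial.coeff_monomial]
    simp [← Fin.ext_iff]
  let R : Finset ℤ := (Λ ×ˢ Λ).biUnion fun z => (f z.1 - f z.2).roots.toFinset
  obtain ⟨B, hB⟩ := R.exists_notMem
  refine ⟨fun j => B ^ (j : ℕ), fun k hk k' hk' h => ?_⟩
  by_contra hne
  refine hB (Finset.mem_biUnion.2 ⟨(k, k'), Finset.mem_product.2 ⟨hk, hk'⟩, ?_⟩)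
  rw [Multiset.mem_toFinset, Polynomial.mem_roots]
  · simp only [Polynomial.IsRoot, Polynomial.eval_sub, f, Polynomial.eval_finsetSum,
      Polynomial.eval_monomial]
    exact sub_eq_zero.2 h
  · intro h0
    refine hne (funext fun j => ?_)
    rw [← hf k j, ← hf k' j, sub_eq_zero.1 h0]

open Polynomial in
lemma le_norm_leadingCoeff_sum_monomial {ι : Type*} {s : Finset ι} {a : ι → ℂ} {n : ι → ℕ} {δ : ℝ}
    (hn : Set.InjOn n s) (hδ : ∀ k ∈ s, a k ≠ 0 → δ ≤ ‖a k‖) (ha : ∃ k ∈ s, a k ≠ 0) :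
    δ ≤ ‖(∑ k ∈ s, monomial (n k) (a k)).leadingCoeff‖ := by
  set g : ℂ[X] := ∑ k ∈ s, monomial (n k) (a k) with hg
  have hcoeff : ∀ k ∈ s, g.coeff (n k) = a k := by
    intro k hk
    rw [hg, finsetSum_coeff, Finset.sum_eq_single_of_mem k hk]
    · simp
    · intro l hl hlk
      rw [coeff_monomial, if_neg fun h => hlk (hn hl hk h)]
  obtain ⟨k, hk, hak⟩ := ha
  have hlc : g.leadingCoeff ≠ 0 := by
    rw [leadingCoeff_ne_zero]
    intro h
    rw [← hcoeff k hk, h] at hak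
    simp at hak
  obtain ⟨l, hl, hne⟩ : ∃ l ∈ s, (monomial (n l) (a l)).coeff g.natDegree ≠ 0 := by
    refine Finset.exists_ne_zero_of_sum_ne_zero ?_
    rwa [← finsetSum_coeff]
  have hnl : n l = g.natDegree := by
    by_contra h
    exact hne (by rw [coeff_monomial, if_neg h])
  rw [leadingCoeff, ← hnl, hcoeff l hl] at hlc ⊢
  exact hδ l hl hlc

/-- Along a separating line, a trigonometric polynomial is, up to a unimodular factor, an algebraic
polynomial evaluated on the unit circle. -/
lemma exists_polynomial_norm_ceval (hp : ∃ k ∈ Λ, p k ≠ 0) :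
    ∃ (v : Fin d → ℝ) (δ : ℝ), 0 < δ ∧ ∀ θ, ∃ g : Polynomial ℂ, δ ≤ ‖g.leadingCoeff‖ ∧
      ∀ t : ℝ, ‖ceval d Λ p (θ + t • v)‖ = ‖g.eval (circleMap 0 1 t)‖ := by
  classical
  obtain ⟨v, hv⟩ := exists_injOn_dot Λ
  obtain ⟨M, hM⟩ : ∃ M : ℤ, ∀ k ∈ Λ, ∑ j, k j * v j ≤ M := by
    obtain ⟨M, hM⟩ := (Λ.image fun k => ∑ j, k j * v j).bddAbove
    exact ⟨M, fun k hk => hM (Finset.mem_coe.2 (Finset.mem_image_of_mem _ hk))⟩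
  obtain ⟨k₀, hk₀, hmin⟩ := (Λ.filter fun k => p k ≠ 0).exists_min_image (fun k => ‖p k‖)
    (by obtain ⟨k, hk, h⟩ := hp; exact ⟨k, Finset.mem_filter.2 ⟨hk, h⟩⟩)
  refine ⟨fun j => v j, ‖p k₀‖, norm_pos_iff.2 (Finset.mem_filter.1 hk₀).2, fun θ => ?_⟩
  let n : (Fin d → ℤ) → ℕ := fun k => (M - ∑ j, k j * v j).toNat
  let a : (Fin d → ℤ) → ℂ := fun k => p k * Complex.exp (-(dotP d k θ : ℂ) * Complex.I)
  have hna : ∀ k, ‖a k‖ = ‖p k‖ := fun k => by simp only [a, norm_mul, norm_character, mul_one]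
  refine ⟨∑ k ∈ Λ, Polynomial.monomial (n k) (a k), ?_, fun t => ?_⟩
  · refine le_norm_leadingCoeff_sum_monomial ?_ ?_ ?_
    · intro k hk l hl h
      have h1 := hM k hk
      have h2 := hM l hl
      refine hv hk hl ?_
      simp only [n] at h ⊢
      omega
    · intro k hk hak
      rw [hna]
      exact hmin k (Finset.mem_filter.2 ⟨hk, fun h => hak (by simp [a, h])⟩)
    · obtain ⟨k, hk, h⟩ := hp
      exact ⟨k, hk, mul_ne_zero h (Complex.exp_ne_zero _)⟩
  · have hfac : (∑ k ∈ Λ, Polynomial.monomial (n k) (a k)).eval (circleMap 0 1 t) =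
        Complex.exp ((M * t : ℝ) * Complex.I) * ceval d Λ p (θ + t • fun j => (v j : ℝ)) := by
      rw [Polynomial.eval_finsetSum, ceval, Finset.mul_sum]
      refine Finset.sum_congr rfl fun k hk => ?_
      have hnk : ((n k : ℕ) : ℂ) = M - ∑ j, (k j : ℂ) * v j := by
        have : ((n k : ℕ) : ℤ) = M - ∑ j, k j * v j := Int.toNat_of_nonneg (by linarith [hM k hk])
        exact_mod_cast congrArg (Int.cast : ℤ → ℂ) this
      have hdot : (dotP d k (fun j => (v j : ℝ)) : ℂ) = ∑ j, (k j : ℂ) * v j := by simp [dotP]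
      rw [Polynomial.eval_monomial, circleMap_zero, Complex.ofReal_one, one_mul,
        ← Complex.exp_nat_mul, hnk, dotP_add_smul]
      simp only [a]
      rw [mul_assoc, ← Complex.exp_add, mul_left_comm _ (p k), ← Complex.exp_add]
      congr 2
      push_cast
      rw [hdot]
      ring
    rw [hfac, norm_mul, Complex.norm_exp_ofReal_mul_I, one_mul]

/-- A nonzero trigonometric polynomial is almost everywhere nonzero, and its logarithm is
integrable. -/
lemma ceval_ne_zero_and_integrable_log (hp : ∃ k ∈ Λ, p k ≠ 0) :
    (∀ᵐ θ ∂dm d, ceval d Λ p θ ≠ 0) ∧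
      Integrable (fun θ => Real.log ‖ceval d Λ p θ‖) (dm d) := by
  classical
  obtain ⟨v, δ, hδ, hline⟩ := exists_polynomial_norm_ceval hp
  set L : ℝ := Real.log (1 + ∑ k ∈ Λ, ‖p k‖)
  have hS : 0 ≤ ∑ k ∈ Λ, ‖p k‖ := Finset.sum_nonneg fun _ _ => norm_nonneg _
  have hL : ∀ θ, Real.log ‖ceval d Λ p θ‖ ≤ L := by
    intro θ
    rcases (norm_nonneg (ceval d Λ p θ)).eq_or_lt with h | h
    · rw [← h, Real.log_zero]
      exact Real.log_nonneg (by linarith)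
    · exact Real.log_le_log h (by linarith [norm_ceval_le (Λ := Λ) (p := p) θ])
  have hmc := (continuous_ceval (Λ := Λ) p).measurable
  have hml : Measurable fun θ => L - Real.log ‖ceval d Λ p θ‖ :=
    measurable_const.sub (Real.measurable_log.comp hmc.norm)
  let G : (Fin d → ℝ) → ENNReal := fun θ =>
    if ceval d Λ p θ = 0 then ⊤ else ENNReal.ofReal (L - Real.log ‖ceval d Λ p θ‖)
  have hG : Measurable G :=
    Measurable.ite (hmc (measurableSet_singleton 0)) measurable_const hml.ennreal_ofReal
  have hbound := two_pi_mul_lintegral_dm_le hG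
    (fun θ n => by simp only [G, ceval_periodic]) v
    (C := ENNReal.ofReal (2 * Real.pi * (L - Real.log δ))) <| by
      intro θ
      obtain ⟨g, hg, hgt⟩ := hline θ
      obtain ⟨h1, h2⟩ := lintegral_log_norm_polynomial_le hδ hg (L := L)
        fun t => by rw [← hgt]; exact hL _
      refine le_trans (le_of_eq ?_) h2
      refine lintegral_congr_ae ((ae_restrict_of_ae h1).mono fun t ht => ?_)
      have hne : ceval d Λ p (θ + t • v) ≠ 0 := by
        rw [← norm_ne_zero_iff, hgt]
        exact norm_ne_zero_iff.2 ht
      simp only [G, if_neg hne, hgt]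
  have hfin : ∫⁻ θ, G θ ∂dm d ≠ ⊤ := by
    intro h
    rw [h, ENNReal.mul_top (by simpa using Real.pi_pos)] at hbound
    exact ENNReal.ofReal_ne_top (top_le_iff.1 hbound)
  have hae : ∀ᵐ θ ∂dm d, ceval d Λ p θ ≠ 0 := by
    filter_upwards [ae_lt_top hG hfin] with θ hθ h
    simp [G, h] at hθ
  refine ⟨hae, ?_⟩
  have hint : Integrable (fun θ => L - Real.log ‖ceval d Λ p θ‖) (dm d) := by
    refine ⟨hml.aestronglyMeasurable, ?_⟩
    rw [hasFiniteIntegral_iff_ofReal (Filter.Eventually.of_forall fun θ => sub_nonneg.2 (hL θ))]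
    refine lt_of_le_of_lt (le_of_eq ?_) hfin.lt_top
    refine lintegral_congr_ae (hae.mono fun θ hθ => ?_)
    simp only [G, if_neg hθ]
  refine ((integrable_const L).sub hint).congr (Filter.Eventually.of_forall fun θ => ?_)
  exact sub_sub_cancel _ _

end TrigPoly
section Fourier

variable {d : ℕ} {Λ : Finset (Fin d → ℤ)} {p : (Fin d → ℤ) → ℂ}

lemma integral_character (k : Fin d → ℤ) :
    ∫ θ, Complex.exp (-(dotP d k θ : ℂ) * Complex.I) ∂dm d = if k = 0 then 1 else 0 := by
  split_ifs with hk
  · simp [hk, dotP]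
  · obtain ⟨j, hj⟩ := Function.ne_iff.1 hk
    have hj' : (k j : ℂ) ≠ 0 := by exact_mod_cast hj
    have hprod : ∀ θ : Fin d → ℝ, Complex.exp (-(dotP d k θ : ℂ) * Complex.I) =
        ∏ j, Complex.exp (-(k j : ℂ) * Complex.I * θ j) := by
      intro θ
      rw [← Complex.exp_sum]
      congr 1
      simp only [dotP, Complex.ofReal_sum, ← Finset.sum_neg_distrib, Finset.sum_mul]
      exact Finset.sum_congr rfl fun j _ => by push_cast; ring
    rw [dm, integral_smul_measure, volume_restrict_Td]
    simp_rw [hprod]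
    rw [integral_fintype_prod_eq_prod
      (f := fun j (x : ℝ) => Complex.exp (-(k j : ℂ) * Complex.I * x)),
      Finset.prod_eq_zero (Finset.mem_univ j), smul_zero]
    rw [← intervalIntegral.integral_of_le (by linarith [Real.pi_pos]),
      integral_exp_mul_complex (mul_ne_zero (neg_ne_zero.2 hj') Complex.I_ne_zero),
      div_eq_zero_iff]
    refine Or.inl (sub_eq_zero.2 ?_)
    rw [Complex.exp_eq_exp_iff_exists_int]
    exact ⟨-k j, by push_cast; ring⟩

lemma integrable_of_continuous_of_norm_le {E : Type*} [NormedAddCommGroup E]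
    [SecondCountableTopology E] {f : (Fin d → ℝ) → E} (hf : Continuous f) (C : ℝ)
    (hC : ∀ θ, ‖f θ‖ ≤ C) : Integrable f (dm d) :=
  Integrable.of_bound hf.aestronglyMeasurable C (Filter.Eventually.of_forall hC)

lemma integrable_ceval : Integrable (ceval d Λ p) (dm d) :=
  integrable_of_continuous_of_norm_le (continuous_ceval p) _ norm_ceval_le

lemma integrable_eval : Integrable (eval d Λ p) (dm d) :=
  integrable_ceval.re

lemma integral_ceval_mul_character {m : Fin d → ℤ} (hm : m ∈ Λ) :
    ∫ θ, ceval d Λ p θ * Complex.exp ((dotP d m θ : ℂ) * Complex.I) ∂dm d = p m := by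
  have h : ∀ θ, ceval d Λ p θ * Complex.exp ((dotP d m θ : ℂ) * Complex.I) =
      ∑ k ∈ Λ, p k * Complex.exp (-(dotP d (k - m) θ : ℂ) * Complex.I) := by
    intro θ
    rw [ceval, Finset.sum_mul]
    refine Finset.sum_congr rfl fun k _ => ?_
    rw [mul_assoc, ← Complex.exp_add]
    congr 2
    simp only [dotP, Pi.sub_apply, Int.cast_sub, sub_mul, Finset.sum_sub_distrib]
    push_cast
    ring
  simp_rw [h]
  rw [integral_finsetSum]
  · simp_rw [integral_const_mul, integral_character, sub_eq_zero]
    simp [hm]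
  · intro k _
    refine Integrable.const_mul (integrable_of_continuous_of_norm_le ?_ 1 fun θ => ?_) _
    · have := continuous_dotP (k - m)
      fun_prop
    · rw [norm_character]

lemma integral_eval (h0 : (0 : Fin d → ℤ) ∈ Λ) : ∫ θ, eval d Λ p θ ∂dm d = (p 0).re := by
  have h := integral_ceval_mul_character (p := p) h0
  simp only [dotP, Pi.zero_apply, Int.cast_zero, zero_mul, Finset.sum_const_zero,
    Complex.ofReal_zero, Complex.exp_zero, mul_one] at h
  rw [← h]
  exact integral_re integrable_ceval

lemma ae_eval_nonneg (hp : p ∈ Pbar d Λ) : ∀ᵐ θ ∂dm d, 0 ≤ eval d Λ p θ :=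
  ae_dm_mem_Td.mono hp.2

lemma norm_coeff_le (h0 : (0 : Fin d → ℤ) ∈ Λ) (hΛ : ∀ k ∈ Λ, -k ∈ Λ) (hp : p ∈ Pbar d Λ)
    (k : Fin d → ℤ) : ‖p k‖ ≤ (p 0).re := by
  have hnonneg : 0 ≤ (p 0).re := by
    rw [← integral_eval h0]
    exact integral_nonneg_of_ae (ae_eval_nonneg hp)
  by_cases hk : k ∈ Λ
  · rw [← integral_ceval_mul_character (p := p) hk, ← integral_eval h0]
    refine norm_integral_le_of_norm_le integrable_eval ((ae_eval_nonneg hp).mono fun θ hθ => ?_)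
    rw [norm_mul, Complex.norm_exp_ofReal_mul_I, mul_one, ceval_eq_eval hΛ hp.1,
      Complex.norm_real, Real.norm_of_nonneg hθ]
  · rw [hp.1.1 k hk, norm_zero]
    exact hnonneg

lemma coeff_zero_im (hp : IsCoeff d Λ p) : (p 0).im = 0 := by
  have h := hp.2 0
  rw [neg_zero] at h
  exact Complex.conj_eq_iff_im.1 h.symm

lemma coeff_zero_re_pos (h0 : (0 : Fin d → ℤ) ∈ Λ) (hΛ : ∀ k ∈ Λ, -k ∈ Λ) (hp : p ∈ Pbar d Λ)
    (hne : p ≠ 0) : 0 < (p 0).re := by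
  obtain ⟨k, hk⟩ := Function.ne_iff.1 hne
  exact (norm_pos_iff.2 hk).trans_le (norm_coeff_le h0 hΛ hp k)

lemma exists_mem_coeff_ne_zero (hp : IsCoeff d Λ p) (hne : p ≠ 0) : ∃ k ∈ Λ, p k ≠ 0 := by
  obtain ⟨k, hk⟩ := Function.ne_iff.1 hne
  exact ⟨k, by_contra fun h => hk (hp.1 k h), hk⟩

lemma ae_eval_pos (hΛ : ∀ k ∈ Λ, -k ∈ Λ) (hp : p ∈ Pbar d Λ) (hne : p ≠ 0) :
    ∀ᵐ θ ∂dm d, 0 < eval d Λ p θ := by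
  filter_upwards [ae_eval_nonneg hp,
    (ceval_ne_zero_and_integrable_log (exists_mem_coeff_ne_zero hp.1 hne)).1] with θ h1 h2
  rw [ceval_eq_eval hΛ hp.1, Complex.ofReal_ne_zero] at h2
  exact lt_of_le_of_ne h1 h2.symm

lemma integrable_log_eval (hΛ : ∀ k ∈ Λ, -k ∈ Λ) (hp : p ∈ Pbar d Λ) (hne : p ≠ 0) :
    Integrable (fun θ => Real.log (eval d Λ p θ)) (dm d) := by
  refine (ceval_ne_zero_and_integrable_log (exists_mem_coeff_ne_zero hp.1 hne)).2.congr
    (Filter.Eventually.of_forall fun θ => ?_)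
  simp only [ceval_eq_eval hΛ hp.1, Complex.norm_real, Real.norm_eq_abs, Real.log_abs]

end Fourier

section Divergence

variable {d : ℕ} {Λ : Finset (Fin d → ℤ)} {P Q : (Fin d → ℤ) → ℂ}

/-- The integrand of the divergence term of `J2`. -/
def divIntegrand (d : ℕ) (Λ : Finset (Fin d → ℤ)) (P Q : (Fin d → ℤ) → ℂ) (θ : Fin d → ℝ) : ℝ :=
  if eval d Λ P θ = 0 then 0
    else eval d Λ P θ * Real.log (eval d Λ P θ / eval d Λ Q θ)

lemma divIntegrand_of_pos {θ : Fin d → ℝ} (hQ : 0 < eval d Λ Q θ) :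
    divIntegrand d Λ P Q θ = eval d Λ P θ * Real.log (eval d Λ P θ) -
      eval d Λ P θ * Real.log (eval d Λ Q θ) := by
  unfold divIntegrand
  split_ifs with h
  · simp [h]
  · rw [Real.log_div h hQ.ne', mul_sub]

lemma norm_eval_le (θ : Fin d → ℝ) : ‖eval d Λ P θ‖ ≤ ∑ k ∈ Λ, ‖P k‖ :=
  (Complex.abs_re_le_norm _).trans (norm_ceval_le θ)

lemma integrable_divIntegrand (hΛ : ∀ k ∈ Λ, -k ∈ Λ) (hP : P ∈ Pbar d Λ) (hP0 : P ≠ 0)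
    (hQ : Q ∈ Pbar d Λ) (hQ0 : Q ≠ 0) : Integrable (divIntegrand d Λ P Q) (dm d) := by
  have h : ∀ {R}, R ∈ Pbar d Λ → R ≠ 0 →
      Integrable (fun θ => eval d Λ P θ * Real.log (eval d Λ R θ)) (dm d) := fun hR hR0 =>
    (integrable_log_eval hΛ hR hR0).bdd_mul (continuous_eval P).aestronglyMeasurable
      (Filter.Eventually.of_forall norm_eval_le)
  refine ((h hP hP0).sub (h hQ hQ0)).congr ((ae_eval_pos hΛ hQ hQ0).mono fun θ hθ => ?_)
  exact (divIntegrand_of_pos hθ).symm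

lemma mul_log_sub_mul_log_ge {a b t : ℝ} (ha : 0 ≤ a) (hb : 0 < b) (ht : 0 < t) :
    a * (1 - Real.log t) - b / t ≤ a * Real.log a - a * Real.log b := by
  rcases ha.eq_or_lt with rfl | ha
  · simpa using by positivity
  · have h := Real.log_le_sub_one_of_pos (show 0 < b / (t * a) by positivity)
    rw [Real.log_div hb.ne' (by positivity), Real.log_mul ht.ne' ha.ne'] at h
    have h2 := mul_le_mul_of_nonneg_left h ha.le
    have h3 : a * (b / (t * a) - 1) = b / t - a := by field_simp
    linarith

lemma integral_divIntegrand_ge (h0 : (0 : Fin d → ℤ) ∈ Λ) (hΛ : ∀ k ∈ Λ, -k ∈ Λ)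
    (hP : P ∈ Pbaro d Λ) (hQ : Q ∈ Pbar d Λ) (hQ0 : Q ≠ 0) {t : ℝ} (ht : 0 < t) :
    1 - Real.log t - (Q 0).re / t ≤ ∫ θ, divIntegrand d Λ P Q θ ∂dm d := by
  have hP0 : P ≠ 0 := by rintro rfl; simpa using hP.2
  have h1 : ∫ θ, (eval d Λ P θ * (1 - Real.log t) - eval d Λ Q θ / t) ∂dm d =
      1 - Real.log t - (Q 0).re / t := by
    rw [integral_sub (integrable_eval.mul_const _) (integrable_eval.div_const _),
      integral_mul_const, integral_div, integral_eval h0, integral_eval h0, hP.2]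
    simp
  rw [← h1]
  refine integral_mono_ae ((integrable_eval.mul_const _).sub (integrable_eval.div_const _))
    (integrable_divIntegrand hΛ hP.1 hP0 hQ hQ0) ?_
  filter_upwards [ae_eval_nonneg hP.1, ae_eval_pos hΛ hQ hQ0] with θ h2 h3
  rw [divIntegrand_of_pos h3]
  exact mul_log_sub_mul_log_ge h2 h3 ht

/-- Lower semicontinuity of the divergence along sequences. -/
lemma integral_divIntegrand_le_of_tendsto (h0 : (0 : Fin d → ℤ) ∈ Λ) (hΛ : ∀ k ∈ Λ, -k ∈ Λ)
    {Pn Qn : ℕ → (Fin d → ℤ) → ℂ} {b : ℕ → ℝ} {B : ℝ}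
    (hPn : ∀ n, Pn n ∈ Pbaro d Λ) (hQn : ∀ n, Qn n ∈ Pbar d Λ) (hQn0 : ∀ n, Qn n ≠ 0)
    (hP : P ∈ Pbaro d Λ) (hQ : Q ∈ Pbar d Λ) (hQ0 : Q ≠ 0)
    (hPlim : Filter.Tendsto Pn Filter.atTop (nhds P))
    (hQlim : Filter.Tendsto Qn Filter.atTop (nhds Q))
    (hb : ∀ n, ∫ θ, divIntegrand d Λ (Pn n) (Qn n) θ ∂dm d ≤ b n)
    (hblim : Filter.Tendsto b Filter.atTop (nhds B)) :
    ∫ θ, divIntegrand d Λ P Q θ ∂dm d ≤ B := by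
  let f : ((Fin d → ℤ) → ℂ) → ((Fin d → ℤ) → ℂ) → (Fin d → ℝ) → ℝ := fun P Q θ =>
    divIntegrand d Λ P Q θ - eval d Λ P θ + eval d Λ Q θ
  have hne : ∀ {P}, P ∈ Pbaro d Λ → P ≠ 0 := by rintro P hP rfl; simpa using hP.2
  have hf : ∀ {P Q}, P ∈ Pbaro d Λ → Q ∈ Pbar d Λ → Q ≠ 0 → Integrable (f P Q) (dm d) :=
    fun hP hQ hQ0 => ((integrable_divIntegrand hΛ hP.1 (hne hP) hQ hQ0).sub
      integrable_eval).add integrable_eval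
  have hfint : ∀ {P Q}, P ∈ Pbaro d Λ → Q ∈ Pbar d Λ → Q ≠ 0 →
      ∫ θ, f P Q θ ∂dm d = ∫ θ, divIntegrand d Λ P Q θ ∂dm d - 1 + (Q 0).re := by
    intro P Q hP hQ hQ0
    have hi := integrable_divIntegrand hΛ hP.1 (hne hP) hQ hQ0
    simp only [f]
    rw [integral_add (f := fun θ => divIntegrand d Λ P Q θ - eval d Λ P θ)
      (hi.sub integrable_eval) integrable_eval, integral_sub hi integrable_eval,
      integral_eval h0, integral_eval h0, hP.2, Complex.one_re]
  have hfnonneg : ∀ {P Q}, P ∈ Pbaro d Λ → Q ∈ Pbar d Λ → Q ≠ 0 → 0 ≤ᵐ[dm d] f P Q := by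
    intro P Q hP hQ hQ0
    filter_upwards [ae_eval_nonneg hP.1, ae_eval_pos hΛ hQ hQ0] with θ h1 h2
    have h3 := mul_log_sub_mul_log_ge h1 h2 one_pos
    simp only [f, divIntegrand_of_pos h2, Pi.zero_apply]
    simp only [Real.log_one, sub_zero, mul_one, div_one] at h3
    linarith
  have heval : ∀ {R : (Fin d → ℤ) → ℂ} {Rn : ℕ → (Fin d → ℤ) → ℂ} (θ),
      Filter.Tendsto Rn Filter.atTop (nhds R) →
      Filter.Tendsto (fun n => eval d Λ (Rn n) θ) Filter.atTop (nhds (eval d Λ R θ)) :=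
    fun θ h => ((continuous_eval_coeff θ).tendsto _).comp h
  have hlim : ∀ᵐ θ ∂dm d, ENNReal.ofReal (f P Q θ) =
      Filter.liminf (fun n => ENNReal.ofReal (f (Pn n) (Qn n) θ)) Filter.atTop := by
    filter_upwards [ae_eval_pos hΛ hQ hQ0] with θ hθ
    refine (Filter.Tendsto.liminf_eq ?_).symm
    refine ENNReal.tendsto_ofReal ?_
    have hp := heval θ hPlim
    have hq := heval θ hQlim
    refine Filter.Tendsto.add (Filter.Tendsto.sub ?_ hp) hq
    rw [divIntegrand_of_pos hθ]
    have h1 := ((Real.continuous_mul_log.tendsto _).comp hp).sub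
      (hp.mul ((Real.continuousAt_log hθ.ne').tendsto.comp hq))
    refine h1.congr' ?_
    filter_upwards [hq.eventually (lt_mem_nhds hθ)] with n hn
    rw [divIntegrand_of_pos hn]
    rfl
  have hQre : Filter.Tendsto (fun n => (Qn n 0).re) Filter.atTop (nhds (Q 0).re) :=
    (Complex.continuous_re.tendsto _).comp (tendsto_pi_nhds.1 hQlim 0)
  have hBlim : Filter.Tendsto (fun n => b n - 1 + (Qn n 0).re) Filter.atTop
      (nhds (B - 1 + (Q 0).re)) := (hblim.sub_const 1).add hQre
  have hfb : ∀ n, ∫ θ, f (Pn n) (Qn n) θ ∂dm d ≤ b n - 1 + (Qn n 0).re := by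
    intro n
    rw [hfint (hPn n) (hQn n) (hQn0 n)]
    linarith [hb n]
  have hBnonneg : 0 ≤ B - 1 + (Q 0).re := ge_of_tendsto' hBlim fun n =>
    (integral_nonneg_of_ae (hfnonneg (hPn n) (hQn n) (hQn0 n))).trans (hfb n)
  have key : ENNReal.ofReal (∫ θ, f P Q θ ∂dm d) ≤ ENNReal.ofReal (B - 1 + (Q 0).re) := by
    rw [ofReal_integral_eq_lintegral_ofReal (hf hP hQ hQ0) (hfnonneg hP hQ hQ0),
      lintegral_congr_ae hlim]
    refine (lintegral_liminf_le' fun n =>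
      (hf (hPn n) (hQn n) (hQn0 n)).1.aemeasurable.ennreal_ofReal).trans ?_
    rw [← (ENNReal.tendsto_ofReal hBlim).liminf_eq]
    refine Filter.liminf_le_liminf (Filter.Eventually.of_forall fun n => ?_)
    rw [← ofReal_integral_eq_lintegral_ofReal (hf (hPn n) (hQn n) (hQn0 n))
      (hfnonneg (hPn n) (hQn n) (hQn0 n))]
    exact ENNReal.ofReal_le_ofReal (hfb n)
  rw [ENNReal.ofReal_le_ofReal_iff hBnonneg, hfint hP hQ hQ0] at key
  linarith

end Divergence

section Compactness

variable {d : ℕ} {Λ : Finset (Fin d → ℤ)}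

lemma continuous_pair (c : (Fin d → ℤ) → ℂ) : Continuous (pair d Λ c) := by
  unfold pair
  fun_prop

lemma isClosed_Pbar : IsClosed (Pbar d Λ) := by
  have h : Pbar d Λ = ((⋂ k, ⋂ (_ : k ∉ Λ), {p : (Fin d → ℤ) → ℂ | p k = 0}) ∩
      ⋂ k, {p : (Fin d → ℤ) → ℂ | p (-k) = starRingEnd ℂ (p k)}) ∩
      ⋂ θ ∈ Td d, {p | 0 ≤ eval d Λ p θ} := by
    ext p
    simp [Pbar, IsCoeff]
  rw [h]
  refine IsClosed.inter (IsClosed.inter ?_ ?_) ?_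
  · exact isClosed_iInter fun k => isClosed_iInter fun _ =>
      isClosed_eq (continuous_apply k) continuous_const
  · exact isClosed_iInter fun k => isClosed_eq (continuous_apply _)
      (Complex.continuous_conj.comp (continuous_apply k))
  · exact isClosed_iInter fun θ => isClosed_iInter fun _ =>
      isClosed_le continuous_const (continuous_eval_coeff θ)

lemma isCompact_Pbar_coeff_zero_le (h0 : (0 : Fin d → ℤ) ∈ Λ) (hΛ : ∀ k ∈ Λ, -k ∈ Λ) (M : ℝ) :
    IsCompact {q ∈ Pbar d Λ | (q 0).re ≤ M} := by
  refine (isCompact_univ_pi fun _ => isCompact_closedBall (0 : ℂ) M).of_isClosed_subset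
    (isClosed_Pbar.inter (isClosed_le (Complex.continuous_re.comp (continuous_apply 0))
      continuous_const)) ?_
  rintro q ⟨hq, hM⟩ k -
  rw [mem_closedBall_zero_iff]
  exact (norm_coeff_le h0 hΛ hq k).trans hM

lemma isClosed_Pbaro : IsClosed (Pbaro d Λ) :=
  isClosed_Pbar.inter (isClosed_eq (continuous_apply 0) continuous_const)

lemma isCompact_Pbaro (h0 : (0 : Fin d → ℤ) ∈ Λ) (hΛ : ∀ k ∈ Λ, -k ∈ Λ) :
    IsCompact (Pbaro d Λ) := by
  refine (isCompact_Pbar_coeff_zero_le h0 hΛ 1).of_isClosed_subset isClosed_Pbaro ?_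
  rintro q ⟨hq, h1⟩
  exact ⟨hq, by simp [h1]⟩

/-- Coercivity of `⟨c, ·⟩` on the cone of nonnegative trigonometric polynomials. -/
lemma exists_pair_ge (h0 : (0 : Fin d → ℤ) ∈ Λ) (hΛ : ∀ k ∈ Λ, -k ∈ Λ) {c : (Fin d → ℤ) → ℂ}
    (hc : c ∈ Cplus d Λ) :
    ∃ ε > 0, ∀ q ∈ Pbar d Λ, q ≠ 0 → ε * (q 0).re ≤ pair d Λ c q := by
  obtain ⟨ε, hε, h⟩ : ∃ ε > 0, ∀ p ∈ Pbaro d Λ, ε ≤ pair d Λ c p := by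
    rcases (Pbaro d Λ).eq_empty_or_nonempty with he | hne
    · exact ⟨1, one_pos, by simp [he]⟩
    · obtain ⟨p, hp, hmin⟩ := (isCompact_Pbaro h0 hΛ).exists_isMinOn hne
        (continuous_pair c).continuousOn
      exact ⟨_, hc.2 p hp.1 (by rintro rfl; simpa using hp.2), fun q hq => hmin hq⟩
  refine ⟨ε, hε, fun q hq hq0 => ?_⟩
  have hpos := coeff_zero_re_pos h0 hΛ hq hq0
  set a : ℝ := (q 0).re with ha
  have hqa : q 0 = (a : ℂ) := Complex.ext rfl (by simp [coeff_zero_im hq.1])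
  have hmem : (fun k => ((a⁻¹ : ℝ) : ℂ) * q k) ∈ Pbaro d Λ := by
    refine ⟨⟨⟨fun k hk => ?_, fun k => ?_⟩, fun θ hθ => ?_⟩, ?_⟩
    · simp [hq.1.1 k hk]
    · simp only [map_mul, Complex.conj_ofReal, hq.1.2]
    · have : eval d Λ (fun k => ((a⁻¹ : ℝ) : ℂ) * q k) θ = a⁻¹ * eval d Λ q θ := by
        simp only [eval, mul_assoc, ← Finset.mul_sum, Complex.re_ofReal_mul]
      rw [this]
      exact mul_nonneg (inv_nonneg.2 hpos.le) (hq.2 θ hθ)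
    · simp only [hqa]
      rw [← Complex.ofReal_mul, inv_mul_cancel₀ hpos.ne', Complex.ofReal_one]
  have hpair : pair d Λ c (fun k => ((a⁻¹ : ℝ) : ℂ) * q k) = a⁻¹ * pair d Λ c q := by
    simp only [pair, map_mul, Complex.conj_ofReal, mul_left_comm (c _), ← Finset.mul_sum,
      Complex.re_ofReal_mul]
  have h1 := h _ hmem
  rw [hpair, le_inv_mul_iff₀ hpos] at h1
  linarith

lemma exists_pair_le (h0 : (0 : Fin d → ℤ) ∈ Λ) (hΛ : ∀ k ∈ Λ, -k ∈ Λ) (γ : (Fin d → ℤ) → ℂ) :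
    ∃ C, ∀ p ∈ Pbaro d Λ, pair d Λ γ p ≤ C := by
  obtain ⟨C, hC⟩ := (isCompact_Pbaro h0 hΛ).bddAbove_image (continuous_pair γ).continuousOn
  exact ⟨C, fun p hp => hC (mem_image_of_mem _ hp)⟩

end Compactness

/-- the sublevel sets of the functional J(P,Q) in
𝔓̄₊,∘ × (𝔓̄₊ \ {0}) are compact. -/
theorem statement16 (d : ℕ) (hd : 1 ≤ d) (Λ : Finset (Fin d → ℤ))
    (h0 : (0 : Fin d → ℤ) ∈ Λ) (hΛ : ∀ k ∈ Λ, -k ∈ Λ)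
    (c γ : (Fin d → ℤ) → ℂ) (hc : c ∈ Cplus d Λ)
    (hγ : IsCoeff d Λ γ) (hγ0 : γ 0 = 1) (r : ℝ) :
    IsCompact {PQ : ((Fin d → ℤ) → ℂ) × ((Fin d → ℤ) → ℂ) |
      PQ ∈ Pbaro d Λ ×ˢ (Pbar d Λ \ {0}) ∧ J2 d Λ c γ PQ.1 PQ.2 ≤ r} := by
  obtain ⟨ε, hε, hcoer⟩ := exists_pair_ge h0 hΛ hc
  obtain ⟨C, hC⟩ := exists_pair_le h0 hΛ γ
  have hJ : ∀ P Q, J2 d Λ c γ P Q =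
      pair d Λ c Q - pair d Λ γ P + ∫ θ, divIntegrand d Λ P Q θ ∂dm d := fun _ _ => rfl
  have hupper : ∀ P ∈ Pbaro d Λ, ∀ Q ∈ Pbar d Λ, Q ≠ 0 → J2 d Λ c γ P Q ≤ r →
      (Q 0).re ≤ 2 / ε * (r + C - 1 + Real.log (2 / ε)) := by
    intro P hP Q hQ hQ0 hr
    have h1 := integral_divIntegrand_ge h0 hΛ hP hQ hQ0 (div_pos two_pos hε)
    have h2 := hcoer Q hQ hQ0
    have h3 := hC P hP
    rw [hJ] at hr
    have h4 : (Q 0).re / (2 / ε) = ε * (Q 0).re / 2 := by field_simp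
    rw [h4] at h1
    rw [div_mul_eq_mul_div, le_div_iff₀ hε]
    linarith
  have hlower : ∀ P ∈ Pbaro d Λ, ∀ Q ∈ Pbar d Λ, Q ≠ 0 → J2 d Λ c γ P Q ≤ r →
      Real.exp (-(r + C)) ≤ (Q 0).re := by
    intro P hP Q hQ hQ0 hr
    have hpos := coeff_zero_re_pos h0 hΛ hQ hQ0
    have h1 := integral_divIntegrand_ge h0 hΛ hP hQ hQ0 hpos
    have h2 := hc.2 Q hQ hQ0
    have h3 := hC P hP
    rw [hJ] at hr
    rw [div_self hpos.ne'] at h1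
    rw [← Real.le_log_iff_exp_le hpos]
    linarith
  refine ((isCompact_Pbaro h0 hΛ).prod (isCompact_Pbar_coeff_zero_le h0 hΛ
    (2 / ε * (r + C - 1 + Real.log (2 / ε))))).of_isClosed_subset ?_ ?_
  · refine IsSeqClosed.isClosed fun x z hx hxz => ?_
    have hP : Filter.Tendsto (fun n => (x n).1) Filter.atTop (nhds z.1) :=
      (continuous_fst.tendsto z).comp hxz
    have hQ : Filter.Tendsto (fun n => (x n).2) Filter.atTop (nhds z.2) :=
      (continuous_snd.tendsto z).comp hxz
    have hzP : z.1 ∈ Pbaro d Λ :=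
      isClosed_Pbaro.mem_of_tendsto hP (Filter.Eventually.of_forall fun n => (hx n).1.1)
    have hzQ : z.2 ∈ Pbar d Λ :=
      isClosed_Pbar.mem_of_tendsto hQ (Filter.Eventually.of_forall fun n => (hx n).1.2.1)
    have hzQ0 : z.2 ≠ 0 := by
      have h1 : Real.exp (-(r + C)) ≤ (z.2 0).re :=
        ge_of_tendsto' ((Complex.continuous_re.tendsto _).comp (tendsto_pi_nhds.1 hQ 0)) fun n =>
          hlower _ (hx n).1.1 _ (hx n).1.2.1 (hx n).1.2.2 (hx n).2
      intro h
      rw [h] at h1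
      exact (Real.exp_pos _).not_ge h1
    refine ⟨⟨hzP, hzQ, hzQ0⟩, ?_⟩
    have hlim := (((continuous_pair (Λ := Λ) γ).tendsto _).comp hP).const_add r |>.sub
      (((continuous_pair (Λ := Λ) c).tendsto _).comp hQ)
    have h := integral_divIntegrand_le_of_tendsto h0 hΛ (fun n => (hx n).1.1)
      (fun n => (hx n).1.2.1) (fun n => (hx n).1.2.2) hzP hzQ hzQ0 hP hQ
      (fun n => by
        have h1 := (hx n).2
        rw [hJ] at h1
        simp only [Function.comp_apply]
        linarith) hlim
    rw [hJ]
    linarith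
  · rintro ⟨P, Q⟩ ⟨⟨hP, hQ, hQ0⟩, hr⟩
    exact ⟨hP, hQ, hupper P hP Q hQ hQ0 hr⟩

end RCE
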